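/- Let p be an odd prime, let j be an integer with 0 ≤ j ≤ p−2, and let t be a positive integer with p ∤ t. Then, as an identity in ℤ_p, Γ_p(⟨tj/(p−1)⟩) · ω(t)^{tj} · ∏_{h=1}^{t−1} Γ_p(h/t) = ∏_{h=0}^{t−1} Γ_p(⟨h/t + j/(p−1)⟩), where ω(t) means ω applied to the reduction of t modulo p, and the rational arguments of Γ_p (which lie in ℚ ∩ ℤ_p since p ∤ t) are regarded as p-adic integers. -/

import Mathlib

/-- The rational `q`, regarded as a `p`-adic integer (when `q ∈ ℚ ∩ ℤ_p`). -/
noncomputable def toZp (p : ℕ) [Fact p.Prime] (q : ℚ) : ℤ_[p] :=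
  if h : ‖(q : ℚ_[p])‖ ≤ 1 then ⟨(q : ℚ_[p]), h⟩ else 0

open Filter Topology

/-- `Γ` is Morita's `p`-adic gamma function. -/
structure IsMoritaGamma (p : ℕ) [Fact p.Prime] (Γ : ℤ_[p] → ℤ_[p]) : Prop where
  continuous : Continuous Γ
  map_zero : Γ 0 = 1
  map_natCast : ∀ m : ℕ, 0 < m →
    Γ (m : ℤ_[p]) = (-1) ^ m * ∏ k ∈ (Finset.Ico 1 m).filter (fun k => ¬ p ∣ k), (k : ℤ_[p])

theorem toZp_eq {p : ℕ} [Fact p.Prime] {q : ℚ} {z : ℤ_[p]} (h : (z : ℚ_[p]) = (q : ℚ_[p])) :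
    toZp p q = z := by
  have hq : ‖(q : ℚ_[p])‖ ≤ 1 := h ▸ z.2
  exact (dif_pos hq).trans (Subtype.ext h.symm)

theorem PadicInt.natCast_dvd_natCast_iff {p : ℕ} [Fact p.Prime] {m : ℕ} :
    (p : ℤ_[p]) ∣ (m : ℤ_[p]) ↔ p ∣ m := by
  rw [← PadicInt.norm_lt_one_iff_dvd, PadicInt.norm_natCast_lt_one_iff]

theorem PadicInt.exists_natCast_mul_eq_one {p : ℕ} [Fact p.Prime] {m : ℕ} (h : ¬ p ∣ m) :
    ∃ u : ℤ_[p], (m : ℤ_[p]) * u = 1 := by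
  refine IsUnit.exists_right_inv (PadicInt.isUnit_iff.2 (PadicInt.norm_natCast_eq_one_iff.2 ?_))
  exact (Nat.Prime.coprime_iff_not_dvd Fact.out).2 h

theorem PadicInt.exists_eq_natCast_add_mul {p : ℕ} [Fact p.Prime] (x : ℤ_[p]) :
    ∃ (r : ℕ) (y : ℤ_[p]), x = r + p * y := by
  obtain ⟨r, -, hr⟩ := PadicInt.exists_mem_range x
  rw [PadicInt.maximalIdeal_eq_span_p, Ideal.mem_span_singleton] at hr
  obtain ⟨y, hy⟩ := hr
  exact ⟨r, y, by rw [← hy]; ring⟩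

theorem PadicInt.tendsto_natCast_pow (p : ℕ) [Fact p.Prime] :
    Tendsto (fun N : ℕ => (p : ℤ_[p]) ^ N) atTop (𝓝 0) :=
  tendsto_pow_atTop_nhds_zero_of_norm_lt_one
    (by simpa using PadicInt.norm_natCast_lt_one_iff (p := p).2 dvd_rfl)

theorem PadicInt.tendsto_pow_pow_of_dvd_sub {p : ℕ} [Fact p.Prime] {x w : ℤ_[p]}
    (hw : w ^ p = w) (h : (p : ℤ_[p]) ∣ x - w) :
    Tendsto (fun N : ℕ => x ^ p ^ N) atTop (𝓝 w) := by
  have hwN : ∀ N : ℕ, w ^ p ^ N = w := by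
    intro N
    induction N with
    | zero => simp
    | succ N ih => rw [pow_succ, pow_mul, ih, hw]
  have hlim : Tendsto (fun N : ℕ => ‖(p : ℤ_[p]) ^ N‖) atTop (𝓝 0) := by
    simpa only [norm_zero] using (PadicInt.tendsto_natCast_pow p).norm
  rw [tendsto_iff_norm_sub_tendsto_zero]
  refine squeeze_zero (fun _ => norm_nonneg _) (fun N => ?_) hlim
  obtain ⟨y, hy⟩ := dvd_sub_pow_of_dvd_sub h N
  rw [hwN] at hy
  rw [hy, pow_succ, mul_assoc, norm_mul]
  exact mul_le_of_le_one_right (norm_nonneg _) (PadicInt.norm_le_one _)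

namespace IsMoritaGamma

variable {p : ℕ} [Fact p.Prime] {Γ : ℤ_[p] → ℤ_[p]}

theorem map_natCast_add_one (hΓ : IsMoritaGamma p Γ) (m : ℕ) :
    Γ ((m : ℤ_[p]) + 1) = -((if p ∣ m then 1 else (m : ℤ_[p])) * Γ m) := by
  rcases Nat.eq_zero_or_pos m with rfl | hm
  · have := hΓ.map_natCast 1 one_pos
    simpa [hΓ.map_zero] using this
  · rw [← Nat.cast_succ, hΓ.map_natCast _ m.succ_pos, hΓ.map_natCast _ hm, Nat.succ_eq_add_one,
      Finset.Ico_add_one_right_eq_Icc, ← Finset.Ico_insert_right hm, Finset.filter_insert]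
    split_ifs with h
    · simp [pow_succ]
    · simp [h, pow_succ]
      ring

theorem map_add_one_of_dvd (hΓ : IsMoritaGamma p Γ) {x : ℤ_[p]} (hx : (p : ℤ_[p]) ∣ x) :
    Γ (x + 1) = -Γ x := by
  have hc := hΓ.continuous
  obtain ⟨y, rfl⟩ := hx
  refine PadicInt.denseRange_natCast.induction_on (p := fun y : ℤ_[p] => Γ (p * y + 1) = -Γ (p * y)) y
    (isClosed_eq (by fun_prop) (by fun_prop)) fun m => ?_
  simpa using hΓ.map_natCast_add_one (p * m)

theorem map_add_one_of_not_dvd (hΓ : IsMoritaGamma p Γ) {x : ℤ_[p]} (hx : ¬ (p : ℤ_[p]) ∣ x) :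
    Γ (x + 1) = -(x * Γ x) := by
  have hc := hΓ.continuous
  obtain ⟨r, y, rfl⟩ := PadicInt.exists_eq_natCast_add_mul x
  have hr : ¬ p ∣ r := fun h =>
    hx (dvd_add (PadicInt.natCast_dvd_natCast_iff.2 h) (dvd_mul_right _ _))
  refine PadicInt.denseRange_natCast.induction_on
    (p := fun y : ℤ_[p] => Γ (r + p * y + 1) = -((r + p * y) * Γ (r + p * y))) y
    (isClosed_eq (by fun_prop) (by fun_prop)) fun m => ?_
  have := hΓ.map_natCast_add_one (r + p * m)
  rw [if_neg (by rwa [Nat.dvd_add_left (dvd_mul_right p m)])] at this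
  exact_mod_cast this

theorem norm_eq_one (hΓ : IsMoritaGamma p Γ) (x : ℤ_[p]) : ‖Γ x‖ = 1 := by
  have hc := hΓ.continuous
  refine PadicInt.denseRange_natCast.induction_on (p := fun x => ‖Γ x‖ = 1) x
    (isClosed_eq (by fun_prop) (by fun_prop)) fun m => ?_
  induction m with
  | zero => simp [hΓ.map_zero]
  | succ m ih =>
    rw [Nat.cast_succ, hΓ.map_natCast_add_one, norm_neg, norm_mul, ih, mul_one]
    split_ifs with h
    · simp
    · exact PadicInt.norm_natCast_eq_one_iff.2 ((Nat.Prime.coprime_iff_not_dvd Fact.out).2 h)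

theorem ne_zero (hΓ : IsMoritaGamma p Γ) (x : ℤ_[p]) : Γ x ≠ 0 :=
  norm_ne_zero_iff.1 (by simp [hΓ.norm_eq_one x])

/-- The Gauss multiplication formula at natural numbers, with `u = 1 / t`. -/
theorem prod_natCast_mul_pow (hΓ : IsMoritaGamma p Γ) {t : ℕ} (ht : 0 < t) {u : ℤ_[p]}
    (hu : (t : ℤ_[p]) * u = 1) (n : ℕ) :
    (∏ h ∈ Finset.range t, Γ ((n + h) * u)) * (t : ℤ_[p]) ^ n =
      Γ n * (∏ h ∈ Finset.Ico 1 t, Γ (h * u)) * (t : ℤ_[p]) ^ ((n + p - 1) / p) := by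
  have hp : p.Prime := Fact.out
  induction n with
  | zero =>
    rw [Finset.range_eq_Ico, Finset.prod_eq_prod_Ico_succ_bot ht,
      Nat.div_eq_of_lt (by have := hp.pos; omega)]
    simp [hΓ.map_zero]
  | succ n ih =>
    have hshift : (∏ h ∈ Finset.range t, Γ (((n + 1 : ℕ) + h) * u)) * Γ (n * u) =
        (∏ h ∈ Finset.range t, Γ ((n + h) * u)) * Γ (n * u + 1) := by
      have e1 := Finset.prod_range_succ' (fun h : ℕ => Γ ((n + h) * u)) t
      have e2 := Finset.prod_range_succ (fun h : ℕ => Γ ((n + h) * u)) t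
      rw [e2] at e1
      rw [show (n : ℤ_[p]) * u + 1 = (n + t) * u by rw [add_mul, hu], e1]
      simp only [Nat.cast_zero, add_zero]
      congr 1
      refine Finset.prod_congr rfl fun h _ => ?_
      push_cast
      ring_nf
    have hexp : (n + 1 + p - 1) / p = (n + p - 1) / p + if p ∣ n then 1 else 0 := by
      rw [show n + 1 + p - 1 = (n + p - 1) + 1 by have := hp.pos; omega, Nat.succ_div]
      simp only [show n + p - 1 + 1 = n + p by have := hp.pos; omega, Nat.dvd_add_self_right]
    have hdvd : (p : ℤ_[p]) ∣ n * u ↔ p ∣ n := by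
      rw [← PadicInt.natCast_dvd_natCast_iff]
      exact (IsUnit.of_mul_eq_one_right _ hu).dvd_mul_right
    apply mul_right_cancel₀ (hΓ.ne_zero (n * u))
    rw [mul_right_comm, hshift, hexp, Nat.cast_succ, hΓ.map_natCast_add_one]
    split_ifs with h
    · rw [hΓ.map_add_one_of_dvd (hdvd.2 h)]
      linear_combination -(t : ℤ_[p]) * Γ (n * u) * ih
    · rw [hΓ.map_add_one_of_not_dvd (hdvd.not.2 h)]
      linear_combination (-(n : ℤ_[p]) * Γ (n * u)) * ih -
        (∏ h ∈ Finset.range t, Γ ((n + h) * u)) * n * Γ (n * u) * t ^ n * hu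

/-- The Gauss multiplication formula at `x = a / (p - 1)`, with `u = 1 / t`. -/
theorem prod_eq_mul_pow (hΓ : IsMoritaGamma p Γ) (hp3 : 3 ≤ p) {t : ℕ} (ht : 0 < t)
    {u : ℤ_[p]} (hu : (t : ℤ_[p]) * u = 1) {a : ℕ} (ha : a < p) {x : ℤ_[p]}
    (hx : ((p : ℤ_[p]) - 1) * x = a) {w : ℤ_[p]} (hw : w ^ (p - 1) = 1)
    (htw : (p : ℤ_[p]) ∣ t - w) :
    ∏ h ∈ Finset.range t, Γ ((x + h) * u) =
      Γ x * w ^ a * ∏ h ∈ Finset.Ico 1 t, Γ (h * u) := by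
  have hp : p.Prime := Fact.out
  obtain ⟨q, rfl⟩ : ∃ q, p = q + 2 := ⟨p - 2, by omega⟩
  generalize hP : q + 2 = P at *
  have hc := hΓ.continuous
  have ht0 : (t : ℤ_[P]) ≠ 0 := left_ne_zero_of_mul_eq_one hu
  obtain ⟨n, hn0, hn⟩ : ∃ n : ℕ → ℕ, n 0 = a ∧ ∀ N, n (N + 1) = n N + q * a * P ^ N :=
    ⟨fun N => Nat.rec a (fun k m => m + q * a * P ^ k) N, rfl, fun _ => rfl⟩
  have hnP : ∀ N, P * n N = n (N + 1) + a := by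
    intro N
    induction N with
    | zero => rw [hn, hn0, ← hP]; ring
    | succ N ih => rw [hn (N + 1), hn N, mul_add, ih, hn N]; ring
  have hdiv : ∀ N, (n (N + 1) + P - 1) / P = n N := fun N => by
    refine Nat.div_eq_of_lt_le ?_ ?_
    · have := hnP N; rw [mul_comm]; omega
    · have := hnP N; rw [add_mul, mul_comm]; omega
  have hnat : ∀ N, (∏ h ∈ Finset.range t, Γ ((n (N + 1) + h) * u)) *
      ((t : ℤ_[P]) ^ P ^ N) ^ (q * a) =
      Γ (n (N + 1)) * ∏ h ∈ Finset.Ico 1 t, Γ (h * u) := by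
    intro N
    have := hΓ.prod_natCast_mul_pow ht hu (n (N + 1))
    rw [hdiv] at this
    apply mul_right_cancel₀ (pow_ne_zero (n N) ht0)
    rw [← this, ← pow_mul, mul_assoc, ← pow_add]
    congr 2
    rw [hn]; ring
  have hlim : Tendsto (fun N => (n (N + 1) : ℤ_[P])) atTop (𝓝 x) := by
    obtain ⟨v, hv⟩ : ∃ v : ℤ_[P], ((P - 1 : ℕ) : ℤ_[P]) * v = 1 :=
      PadicInt.exists_natCast_mul_eq_one fun h => by
        have := Nat.le_of_dvd (by omega) h
        omega
    rw [Nat.cast_sub (by omega), Nat.cast_one] at hv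
    have hform : ∀ N : ℕ, (n N : ℤ_[P]) = x + q * a * v * P ^ N := fun N => by
      have h1 : ((P : ℤ_[P]) * n N) = n N + q * a * P ^ N + a := by exact_mod_cast hn N ▸ hnP N
      linear_combination v * h1 + (x - n N) * hv - v * hx
    have := ((PadicInt.tendsto_natCast_pow P).const_mul ((q : ℤ_[P]) * a * v)).const_add x
    rw [mul_zero, add_zero] at this
    refine (tendsto_add_atTop_iff_nat (f := fun N => (n N : ℤ_[P])) 1).2 ?_
    simpa only [hform] using this
  have hwP : w ^ P = w := by
    have := pow_succ w (P - 1)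
    rwa [hw, one_mul, Nat.sub_add_cancel hp.one_le] at this
  have hpow := (PadicInt.tendsto_pow_pow_of_dvd_sub hwP htw).pow (q * a)
  have hprod : Tendsto (fun N => ∏ h ∈ Finset.range t, Γ ((n (N + 1) + h) * u)) atTop
      (𝓝 (∏ h ∈ Finset.range t, Γ ((x + h) * u))) :=
    ((by fun_prop : Continuous fun y : ℤ_[P] =>
      ∏ h ∈ Finset.range t, Γ ((y + h) * u)).tendsto x).comp hlim
  have hright := ((hc.tendsto x).comp hlim).mul_const (∏ h ∈ Finset.Ico 1 t, Γ (h * u))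
  have hleft := hprod.mul hpow
  simp only [hnat] at hleft
  have key := tendsto_nhds_unique hleft hright
  have hw1 : w ^ (q * a) * w ^ a = 1 := by
    rw [← pow_add, show q * a + a = (P - 1) * a by rw [← hP]; simp; ring, pow_mul, hw, one_pow]
  linear_combination w ^ a * key - (∏ h ∈ Finset.range t, Γ ((x + h) * u)) * hw1

end IsMoritaGamma

theorem Finset.prod_range_add_mod {M : Type*} [CommMonoid M] (f : ℕ → M) (t s : ℕ) :
    ∏ h ∈ Finset.range t, f ((h + s) % t) = ∏ h ∈ Finset.range t, f h := by
  induction s with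
  | zero =>
    refine Finset.prod_congr rfl fun h hh => ?_
    rw [add_zero, Nat.mod_eq_of_lt (Finset.mem_range.1 hh)]
  | succ s ih =>
    rcases t with _ | t
    · simp
    · rw [← ih, Finset.prod_range_succ, Finset.prod_range_succ', zero_add,
        show t + (s + 1) = s + (t + 1) by ring, Nat.add_mod_right]
      simp only [add_assoc, add_comm 1 s]

theorem fract_div_add_div_div {t : ℕ} (ht : 0 < t) (m : ℕ) {y : ℚ} (hy0 : 0 ≤ y) (hy1 : y < 1) :
    Int.fract (((m : ℚ) + y) / t) = (((m % t : ℕ) : ℚ) + y) / t := by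
  have htq : (0 : ℚ) < t := by exact_mod_cast ht
  rw [Int.fract_eq_iff]
  refine ⟨by positivity, ?_, ((m / t : ℕ) : ℤ), ?_⟩
  · rw [div_lt_one htq]
    have : ((m % t : ℕ) : ℚ) + 1 ≤ t := by exact_mod_cast Nat.mod_lt m ht
    linarith
  · have : (m : ℚ) = (m % t : ℕ) + t * (m / t : ℕ) := by exact_mod_cast (Nat.mod_add_div m t).symm
    rw [Int.cast_natCast]
    field_simp
    linear_combination this

/-- **Lemma (4.1), first identity**: for `0 ≤ j ≤ p-2` and `p ∤ t`,
`Γ_p(⟨tj/(p-1)⟩) · ω(t)^{tj} · ∏_{h=1}^{t-1} Γ_p(h/t) = ∏_{h=0}^{t-1} Γ_p(⟨h/t + j/(p-1)⟩)`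
as an identity in `ℤ_p`. Here `Γ` is Morita's `p`-adic gamma function and `ω` the
Teichmüller character, each characterized by the stated hypotheses. -/
theorem padic_gamma_mult_pos (p : ℕ) [Fact p.Prime] (hodd : Odd p)
    (Γ : ℤ_[p] → ℤ_[p]) (hΓcont : Continuous Γ) (hΓzero : Γ 0 = 1)
    (hΓnat : ∀ m : ℕ, 0 < m →
      Γ (m : ℤ_[p]) = (-1) ^ m * ∏ k ∈ (Finset.Ico 1 m).filter (fun k => ¬ p ∣ k), (k : ℤ_[p]))
    (ω : ZMod p → ℤ_[p]) (hω0 : ω 0 = 0)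
    (hωmul : ∀ x y : ZMod p, ω (x * y) = ω x * ω y)
    (hωunit : ∀ x : ZMod p, x ≠ 0 → IsUnit (ω x))
    (hωcong : ∀ x : ZMod p, (p : ℤ_[p]) ∣ (ω x - (x.val : ℤ_[p])))
    (j : ℕ) (hj : j ≤ p - 2) (t : ℕ) (ht : 0 < t) (hpt : ¬ p ∣ t) :
    Γ (toZp p (Int.fract ((t * j : ℚ) / ((p : ℚ) - 1)))) * ω (t : ZMod p) ^ (t * j) *
        ∏ h ∈ Finset.Ico 1 t, Γ (toZp p ((h : ℚ) / (t : ℚ))) =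
      ∏ h ∈ Finset.range t,
        Γ (toZp p (Int.fract ((h : ℚ) / (t : ℚ) + (j : ℚ) / ((p : ℚ) - 1)))) := by
  have hp : p.Prime := Fact.out
  have hp3 : 3 ≤ p := by
    have := hp.two_le
    rcases hodd with ⟨k, hk⟩
    omega
  have hΓ : IsMoritaGamma p Γ := ⟨hΓcont, hΓzero, hΓnat⟩
  obtain ⟨u, hu⟩ := PadicInt.exists_natCast_mul_eq_one hpt
  obtain ⟨v, hv⟩ := PadicInt.exists_natCast_mul_eq_one (p := p) (m := p - 1) fun h => by
    have := Nat.le_of_dvd (by omega) h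
    omega
  have htq : (t : ℚ) ≠ 0 := by exact_mod_cast ht.ne'
  have hcast : ((p - 1 : ℕ) : ℚ) = (p : ℚ) - 1 := by rw [Nat.cast_sub (by omega), Nat.cast_one]
  have hpq : ((p - 1 : ℕ) : ℚ) ≠ 0 := by exact_mod_cast (by omega : p - 1 ≠ 0)
  have huq : (u : ℚ_[p]) = (t : ℚ_[p])⁻¹ :=
    eq_inv_of_mul_eq_one_right (by exact_mod_cast congrArg ((↑) : ℤ_[p] → ℚ_[p]) hu)
  have hvq : (v : ℚ_[p]) = ((p - 1 : ℕ) : ℚ_[p])⁻¹ :=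
    eq_inv_of_mul_eq_one_right (by exact_mod_cast congrArg ((↑) : ℤ_[p] → ℚ_[p]) hv)
  -- `ω t` is a `(p - 1)`-st root of unity congruent to `t`
  have htz : (t : ZMod p) ≠ 0 := by rwa [Ne, ZMod.natCast_eq_zero_iff]
  have hω1 : ω 1 = 1 := by
    have h1 := hωmul 1 1
    rw [mul_one] at h1
    exact (mul_eq_left₀ (hωunit 1 one_ne_zero).ne_zero).1 h1.symm
  have hωpow : ∀ k : ℕ, ω ((t : ZMod p) ^ k) = ω t ^ k := fun k => by
    induction k with
    | zero => simp [hω1]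
    | succ k ih => rw [pow_succ, hωmul, ih, pow_succ]
  have hw : ω t ^ (p - 1) = 1 := by rw [← hωpow, ZMod.pow_card_sub_one_eq_one htz, hω1]
  have htw : (p : ℤ_[p]) ∣ t - ω t := by
    have h1 := hωcong t
    rw [ZMod.val_natCast] at h1
    have h2 : (t : ℤ_[p]) = (t % p : ℕ) + p * (t / p : ℕ) := by
      exact_mod_cast (Nat.mod_add_div t p).symm
    have h3 : (t : ℤ_[p]) - ω t = p * (t / p : ℕ) - (ω t - (t % p : ℕ)) := by
      linear_combination h2
    rw [h3]
    exact dvd_sub (dvd_mul_right _ _) h1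
  set a := t * j % (p - 1) with ha
  set s := t * j / (p - 1) with hs
  have has : t * j = a + (p - 1) * s := (Nat.mod_add_div _ _).symm
  have hap : a < p - 1 := Nat.mod_lt _ (by omega)
  have hasq : (t : ℚ) * j = a + (p - 1 : ℕ) * s := by exact_mod_cast has
  have hy0 : (0 : ℚ) ≤ (a : ℚ) / (p - 1 : ℕ) := by positivity
  have hy1 : (a : ℚ) / (p - 1 : ℕ) < 1 := by
    rw [div_lt_one (by positivity)]
    exact_mod_cast hap
  have hfirst : toZp p (Int.fract ((t * j : ℚ) / ((p : ℚ) - 1))) = a * v := by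
    apply toZp_eq
    rw [← hcast, show (t * j : ℚ) / (p - 1 : ℕ) = (a : ℚ) / (p - 1 : ℕ) + s by
      rw [hasq]; field_simp, Int.fract_add_natCast, Int.fract_eq_self.2 ⟨hy0, hy1⟩]
    push_cast
    rw [hvq, div_eq_mul_inv]
  have hsecond : ∀ h : ℕ, toZp p ((h : ℚ) / (t : ℚ)) = h * u := fun h => by
    apply toZp_eq
    push_cast
    rw [huq, div_eq_mul_inv]
  have hthird : ∀ h : ℕ, toZp p (Int.fract ((h : ℚ) / (t : ℚ) + (j : ℚ) / ((p : ℚ) - 1))) =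
      (a * v + ((h + s) % t : ℕ)) * u := fun h => by
    apply toZp_eq
    rw [← hcast, show (h : ℚ) / (t : ℚ) + (j : ℚ) / (p - 1 : ℕ) =
      (((h + s : ℕ) : ℚ) + (a : ℚ) / (p - 1 : ℕ)) / t by
        field_simp
        push_cast
        linear_combination hasq, fract_div_add_div_div ht _ hy0 hy1]
    push_cast
    rw [huq, hvq]
    ring
  simp only [hfirst, hsecond, hthird]
  rw [Finset.prod_range_add_mod (fun h => Γ ((a * v + h) * u)),
    hΓ.prod_eq_mul_pow hp3 ht hu (by omega : a < p) (x := a * v) _ hw htw, has, pow_add, pow_mul,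
    hw, one_pow, mul_one]
  rw [Nat.cast_sub (by omega), Nat.cast_one] at hv
  linear_combination (a : ℤ_[p]) * hv
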